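/- Let m, n be positive even integers, A the set of vertical edges of T_{m,n} between rows m-1 and 0, B the set of horizontal edges between columns n-1 and 0. For positive integer vectors h = (h_0,...,h_{m-1}) and v = (v_0,...,v_{n-1}), let E(h,v) be the set of perfect matchings M with |M∩A| and |M∩B| both even having exactly h_i horizontal edges in row i and v_j vertical edges in column j, and O(h,v) the analogous set of matchings for which not both intersections are even. Then |E(h,v)| = |O(h,v)|. -/

import Mathlib

/-- Vertex set of the toroidal grid: `ZMod m × ZMod n`. -/
abbrev TorV (m n : ℕ) := ZMod m × ZMod n

/-- Adjacency in the toroidal grid `T_{m,n}`: equal in one coordinate,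
differing by exactly 1 (mod `m` or `n`) in the other. -/
def torAdj (m n : ℕ) (a b : TorV m n) : Prop :=
  (a.1 = b.1 ∧ (a.2 = b.2 + 1 ∨ b.2 = a.2 + 1)) ∨
  (a.2 = b.2 ∧ (a.1 = b.1 + 1 ∨ b.1 = a.1 + 1))

/-- `M` is a perfect matching of `T_{m,n}`: every element is an edge of the grid,
and every vertex belongs to exactly one element of `M`. -/
def IsPM (m n : ℕ) (M : Finset (Sym2 (TorV m n))) : Prop :=
  (∀ e ∈ M, ∀ a b : TorV m n, e = s(a, b) → torAdj m n a b) ∧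
  ∀ v : TorV m n, ∃! e, e ∈ M ∧ v ∈ e

/-- A vertex `(i,j)` is black when `i + j` is even. -/
def IsBlack {m n : ℕ} (v : TorV m n) : Prop := Even (v.1.val + v.2.val)

/-- `u`, `v`, `w` lie in a common row or a common column. -/
def Collin {m n : ℕ} (u v w : TorV m n) : Prop :=
  (u.1 = v.1 ∧ v.1 = w.1) ∨ (u.2 = v.2 ∧ v.2 = w.2)

/-- The arc relation of the digraph `D_{m,n}(M)`: a black vertex points along its
matching edge; a white vertex `v` with matching edge `uv` points to the neighbor `w`
with `u,v,w` collinear and `vw ∉ M`. -/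
def dArc (m n : ℕ) (M : Finset (Sym2 (TorV m n))) (v w : TorV m n) : Prop :=
  (IsBlack v ∧ torAdj m n v w ∧ s(v, w) ∈ M) ∨
  (¬ IsBlack v ∧ torAdj m n v w ∧ s(v, w) ∉ M ∧ ∃ u, s(u, v) ∈ M ∧ Collin u v w)

/-- A directed cycle of `D_{m,n}(M)`, given by a `k`-periodic sequence of distinct
vertices following arcs of the digraph. -/
def IsDiCycle (m n : ℕ) (M : Finset (Sym2 (TorV m n))) (k : ℕ) (f : ℕ → TorV m n) : Prop :=
  0 < k ∧ (∀ i < k, ∀ j < k, f i = f j → i = j) ∧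
  (∀ i, f (i + k) = f i) ∧ ∀ i, dArc m n M (f i) (f (i + 1))

/-- The underlying undirected edge set `U(C)` of a directed cycle. -/
def cycEdges {m n : ℕ} (k : ℕ) (f : ℕ → TorV m n) : Finset (Sym2 (TorV m n)) :=
  (Finset.range k).image (fun i => s(f i, f (i + 1)))

/-- The vertex set of a directed cycle. -/
def cycVerts {m n : ℕ} (k : ℕ) (f : ℕ → TorV m n) : Finset (TorV m n) :=
  (Finset.range k).image f

/-- The layer `A` of wrap-around vertical edges, between rows `m-1` and `0`. -/
def layerA (m n : ℕ) [NeZero n] : Finset (Sym2 (TorV m n)) :=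
  Finset.univ.image (fun j : ZMod n => s(((0 : ZMod m), j), ((-1 : ZMod m), j)))

/-- The layer `B` of wrap-around horizontal edges, between columns `n-1` and `0`. -/
def layerB (m n : ℕ) [NeZero m] : Finset (Sym2 (TorV m n)) :=
  Finset.univ.image (fun i : ZMod m => s((i, (0 : ZMod n)), (i, (-1 : ZMod n))))

/-- The horizontal edges of row `i`. -/
def rowEdges (m n : ℕ) [NeZero n] (i : ZMod m) : Finset (Sym2 (TorV m n)) :=
  Finset.univ.image (fun j : ZMod n => s((i, j), (i, j + 1)))

/-- The vertical edges of column `j`. -/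
def colEdges (m n : ℕ) [NeZero m] (j : ZMod n) : Finset (Sym2 (TorV m n)) :=
  Finset.univ.image (fun i : ZMod m => s((i, j), (i + 1, j)))

/-- The sign character of `ZMod 2`. -/
def eps (x : ZMod 2) : ℤ := if x = 0 then 1 else -1

lemma eps_add (x y : ZMod 2) : eps (x + y) = eps x * eps y := by
  revert x y; decide

lemma eps_sum {ι : Type*} (s : Finset ι) (f : ι → ZMod 2) :
    eps (∑ i ∈ s, f i) = ∏ i ∈ s, eps (f i) := by
  classical
  induction s using Finset.induction_on with
  | empty => simp [eps]
  | insert a s ha ih => rw [Finset.sum_insert ha, Finset.prod_insert ha, eps_add, ih]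

lemma zmod2_add_self (x : ZMod 2) : x + x = 0 := by revert x; decide

lemma sum_pairs {N : ℕ} (G : Fin N → Fin N → ZMod 2) :
    ∑ a' : Fin N, ∑ a ∈ Finset.Iio a', (G a a' + G a' a) =
      ∑ a, ∑ a', G a a' + ∑ a, G a a := by
  have h1 : ∀ a' : Fin N, ∑ a, G a' a =
      ∑ a ∈ Finset.Iio a', G a' a + ∑ a ∈ Finset.Ioi a', G a' a + G a' a' := by
    intro a'
    have hu : (Finset.univ : Finset (Fin N)) =
        insert a' (Finset.Iio a' ∪ Finset.Ioi a') := by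
      ext x; simp; omega
    have hd : Disjoint (Finset.Iio a') (Finset.Ioi a') := by
      rw [Finset.disjoint_left]; intro x; simp; omega
    rw [hu, Finset.sum_insert (by simp), Finset.sum_union hd]; ring
  have h2 : ∑ a' : Fin N, ∑ a ∈ Finset.Ioi a', G a' a =
      ∑ a' : Fin N, ∑ a ∈ Finset.Iio a', G a a' := by
    apply Finset.sum_comm'
    intro x y; simp
  simp only [Finset.sum_add_distrib, h1, h2]
  have := zmod2_add_self (∑ a, G a a)
  linear_combination -this

lemma sign_formula {N : ℕ} {V : Type*} (L : V → V → ZMod 2)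
    (hL : ∀ x y, x ≠ y → L x y + L y x = 1) (β ω : Fin N → V)
    (hω : ∀ a a', a < a' → L (ω a) (ω a') = 0)
    (hωi : Function.Injective ω)
    (hβω : ∀ a b, β a ≠ ω b) :
    ∃ C : ZMod 2, ∀ σ : Equiv.Perm (Fin N), ((Equiv.Perm.sign σ : ℤˣ) : ℤ) =
      eps (C + ∑ a, L (β a) (ω (σ a)) + ∑ a' : Fin N, ∑ a ∈ Finset.Iio a',
        ((L (β a) (β a') + L (β a) (ω (σ a'))) +
          (L (ω (σ a)) (β a') + L (ω (σ a)) (ω (σ a'))))) := by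
  refine ⟨∑ a' : Fin N, ∑ a ∈ Finset.Iio a', (L (β a) (β a') + 1) +
    ∑ a, ∑ a', L (β a) (ω a'), fun σ => ?_⟩
  have hs : ((Equiv.Perm.sign σ : ℤˣ) : ℤ) =
      eps (∑ a' : Fin N, ∑ a ∈ Finset.Iio a', L (ω (σ a)) (ω (σ a'))) := by
    rw [Equiv.Perm.sign_eq_prod_prod_Iio, eps_sum]
    simp only [eps_sum]
    push_cast
    refine Finset.prod_congr rfl fun a' _ => Finset.prod_congr rfl fun a ha => ?_
    have hne : σ a ≠ σ a' := by
      intro h; have := σ.injective h; simp [this] at ha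
    split_ifs with h
    · rw [hω _ _ h]; simp [eps]
    · have h3 : σ a' < σ a := by omega
      have h4 := hL _ _ (fun h => hne (hωi h))
      rw [hω _ _ h3, add_zero] at h4
      rw [h4]; decide
  rw [hs]
  congr 1
  have h1 := sum_pairs (fun a a' => L (β a) (ω (σ a')))
  have h2 : ∀ a' : Fin N, ∀ a, L (ω (σ a)) (β a') = 1 + L (β a') (ω (σ a)) := by
    intro a' a
    have h4 := hL _ _ (hβω a' (σ a))
    have := zmod2_add_self (L (β a') (ω (σ a)))
    linear_combination h4 - this
  have h3 : ∀ a, ∑ a', L (β a) (ω (σ a')) = ∑ a', L (β a) (ω a') :=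
    fun a => Equiv.sum_comp σ (fun a' => L (β a) (ω a'))
  simp only [h3] at h1
  simp only [h2]
  simp only [Finset.sum_add_distrib] at h1 ⊢
  have e1 := zmod2_add_self (∑ a' : Fin N, ∑ a ∈ Finset.Iio a', L (β a) (β a'))
  have e2 := zmod2_add_self (∑ a' : Fin N, ∑ a ∈ Finset.Iio a', (1 : ZMod 2))
  have e3 := zmod2_add_self (∑ a, ∑ a', L (β a) (ω a'))
  have e4 := zmod2_add_self (∑ a, L (β a) (ω (σ a)))
  linear_combination -h1 - e1 - e2 - e3 - e4

/-- Lexicographic inversion indicator on pairs of naturals. -/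
def LN (a b c d : ℕ) : ZMod 2 := if c < a ∨ (c = a ∧ d < b) then 1 else 0

/-- Cyclic successor on `{0, …, m-1}`. -/
def cs (m i : ℕ) : ℕ := if i + 1 = m then 0 else i + 1

/-- indicator of a proposition in `ZMod 2` -/
def ind (p : Prop) [Decidable p] : ZMod 2 := if p then 1 else 0

lemma LN_eq0 {a b c d : ℕ} (h : a < c ∨ (a = c ∧ b ≤ d)) : LN a b c d = 0 := by
  unfold LN; rw [if_neg]; omega

lemma LN_eq1 {a b c d : ℕ} (h : c < a ∨ (c = a ∧ d < b)) : LN a b c d = 1 := by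
  unfold LN; rw [if_pos h]

lemma ind_eq0 {p : Prop} [Decidable p] (h : ¬ p) : ind p = 0 := if_neg h
lemma ind_eq1 {p : Prop} [Decidable p] (h : p) : ind p = 1 := if_pos h

lemma LN_row {a c : ℕ} (h : a ≠ c) (b d : ℕ) : LN a b c d = ind (c < a) := by
  unfold LN ind; congr 1; simp; omega

lemma LN_same (a b d : ℕ) : LN a b a d = ind (d < b) := by
  unfold LN ind; congr 1; simp

/-- horizontal against horizontal -/
lemma loc_hh {n i j i' j' : ℕ} (hj : j < n) (hj' : j' < n)
    (h1 : i = i' → j ≠ j' ∧ j ≠ cs n j' ∧ cs n j ≠ j') :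
    (LN i j i' j' + LN i j i' (cs n j')) + (LN i (cs n j) i' j' + LN i (cs n j) i' (cs n j'))
      = 0 := by
  by_cases h : i = i'
  · obtain ⟨h2, h3, h4⟩ := h1 h
    subst h
    simp only [LN_same]
    unfold cs at *
    split_ifs at * with a b b
    · omega
    all_goals
      rcases lt_trichotomy j j' with c | c | c
      · unfold ind; repeat rw [if_pos (by omega)]
        all_goals first | decide | (split_ifs <;> first | omega | decide)
      · omega
      · unfold ind; split_ifs <;> first | omega | decide
  · simp only [LN_row h, zmod2_add_self]

/-- horizontal against vertical -/
lemma loc_hv {m n i j i' j' : ℕ} (hj' : j' < n)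
    (h1 : i = i' → j ≠ j' ∧ cs n j ≠ j') (h2 : i = cs m i' → j ≠ j' ∧ cs n j ≠ j') :
    (LN i j i' j' + LN i j (cs m i') j') + (LN i (cs n j) i' j' + LN i (cs n j) (cs m i') j')
      = ind (j + 1 = n) * (ind (i' = i) + ind (cs m i' = i)) := by
  have key : ∀ k, (i = k → j ≠ j' ∧ cs n j ≠ j') →
      LN i j k j' + LN i (cs n j) k j' = ind (j + 1 = n) * ind (k = i) := by
    intro k hk
    by_cases h : i = k
    · obtain ⟨h3, h4⟩ := hk h
      subst h
      simp only [LN_same]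
      unfold cs ind at *
      split_ifs at * <;> first | omega | decide
    · rw [LN_row h, LN_row h, zmod2_add_self, ind_eq0 (p := k = i) (by omega), mul_zero]
  have a := key _ h1
  have b := key _ h2
  linear_combination a + b

lemma cs_cases (m i : ℕ) : (i + 1 = m ∧ cs m i = 0) ∨ (i + 1 ≠ m ∧ cs m i = i + 1) := by
  unfold cs; split_ifs with h <;> simp [h]

/-- vertical against vertical -/
lemma loc_vv {m i j i' j' : ℕ} (hm : 2 < m) (hi : i < m) (hi' : i' < m)
    (h1 : i = i' → j ≠ j') (h2 : i = cs m i' → j ≠ j') (h3 : cs m i = i' → j ≠ j') :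
    (LN i j i' j' + LN i j (cs m i') j') + (LN (cs m i) j i' j' + LN (cs m i) j (cs m i') j')
      = ind (j' < j) * (ind (i' = cs m i) + ind (cs m i' = cs m i)) +
        ind (j < j') * (ind (i = cs m i') + ind (cs m i = cs m i')) := by
  have e := cs_cases m i
  have e' := cs_cases m i'
  generalize cs m i = s at *
  generalize cs m i' = s' at *
  by_cases c1 : i = i'
  · have : s = s' := by omega
    subst this
    subst c1
    have a := h1 rfl
    have b : i ≠ s := by omega
    rw [LN_same, LN_same, LN_row b, LN_row b.symm, ind_eq0 b, ind_eq1 (p := s = s) rfl]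
    unfold ind
    split_ifs <;> first | omega | decide
  have n1 : s ≠ s' := by omega
  rw [ind_eq0 n1, ind_eq0 n1.symm, LN_row c1, LN_row n1]
  by_cases c2 : i' = s
  · have a := h3 c2.symm
    have c3 : i ≠ s' := by omega
    rw [ind_eq1 c2, ind_eq0 c3, LN_row c3, c2, LN_same]
    unfold ind
    split_ifs <;> first | omega | decide
  by_cases c3 : i = s'
  · have a := h2 c3
    rw [ind_eq0 c2, ind_eq1 c3, LN_row (Ne.symm c2), ← c3, LN_same]
    unfold ind
    split_ifs <;> first | omega | decide
  rw [ind_eq0 c2, ind_eq0 c3, LN_row c3, LN_row (Ne.symm c2)]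
  unfold ind
  split_ifs <;> first | omega | decide

section Grid
variable {m n : ℕ} [NeZero m] [NeZero n]

lemma val_succ (i : ZMod m) : (i + 1).val = cs m i.val := by
  have hm : 0 < m := Nat.pos_of_ne_zero (NeZero.ne m)
  have hi := ZMod.val_lt i
  unfold cs
  rw [ZMod.val_add, ZMod.val_one_eq_one_mod, Nat.add_mod_mod]
  split_ifs with h
  · rw [h, Nat.mod_self]
  · rw [Nat.mod_eq_of_lt (by omega)]

lemma val_succ_eq (i : ZMod m) : i.val + 1 = m ↔ i = -1 := by
  constructor
  · intro h
    have : ((i.val + 1 : ℕ) : ZMod m) = 0 := by rw [h]; simp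
    push_cast at this
    rw [ZMod.natCast_zmod_val] at this
    linear_combination this
  · intro h
    have h2 := val_succ i
    have : i + 1 = 0 := by rw [h]; ring
    rw [this, ZMod.val_zero] at h2
    rcases cs_cases m i.val with h3 | h3
    · exact h3.1
    · omega

/-- Lexicographic inversion indicator on the torus. -/
def LV (u v : TorV m n) : ZMod 2 := LN u.1.val u.2.val v.1.val v.2.val

lemma LV_anti (u v : TorV m n) (h : u ≠ v) : LV u v + LV v u = 1 := by
  have : u.1.val ≠ v.1.val ∨ u.2.val ≠ v.2.val := by
    by_contra! h2
    exact h (Prod.ext (ZMod.val_injective m h2.1) (ZMod.val_injective n h2.2))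
  unfold LV LN
  split_ifs <;> first | omega | decide

/-- Second endpoint of a parametrised edge: `true` is horizontal, `false` vertical. -/
def hd (p : TorV m n × Bool) : TorV m n :=
  if p.2 then (p.1.1, p.1.2 + 1) else (p.1.1 + 1, p.1.2)

/-- Half of the crossing indicator. -/
def rho (p q : TorV m n × Bool) : ZMod 2 :=
  if q.2 then 0 else
    if p.2 then ind (p.1.2 = -1) * (ind (q.1.1 = p.1.1) + ind (q.1.1 + 1 = p.1.1))
    else ind (q.1.2.val < p.1.2.val) * (ind (q.1.1 = p.1.1 + 1) + ind (q.1.1 + 1 = p.1.1 + 1))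

lemma ind_congr {p q : Prop} [Decidable p] [Decidable q] (h : p ↔ q) : ind p = ind q := by
  unfold ind; simp [h]

lemma val_eq_iff (i j : ZMod m) : i.val = j.val ↔ i = j :=
  ⟨fun h => ZMod.val_injective m h, fun h => h ▸ rfl⟩

lemma loc_hv' (i i' : ZMod m) (j j' : ZMod n)
    (h1 : ((i, j) : TorV m n) ≠ (i', j')) (h2 : ((i, j) : TorV m n) ≠ (i' + 1, j'))
    (h3 : ((i, j + 1) : TorV m n) ≠ (i', j')) (h4 : ((i, j + 1) : TorV m n) ≠ (i' + 1, j')) :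
    (LV (i, j) (i', j') + LV (i, j) (i' + 1, j')) +
      (LV (i, j + 1) (i', j') + LV (i, j + 1) (i' + 1, j')) =
    ind (j = -1) * (ind (i' = i) + ind (i' + 1 = i)) := by
  simp only [LV, val_succ]
  simp only [ne_eq, Prod.mk.injEq, ← val_eq_iff, val_succ] at h1 h2 h3 h4
  rw [loc_hv (n := n) (ZMod.val_lt j') (by tauto) (by tauto)]
  rw [ind_congr (val_succ_eq j), ind_congr (val_eq_iff i' i), ← val_succ,
    ind_congr (val_eq_iff (i' + 1) i)]

lemma loc_all (hm : 2 < m) (p q : TorV m n × Bool) (h1 : p.1 ≠ q.1) (h2 : p.1 ≠ hd q)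
    (h3 : hd p ≠ q.1) (h4 : hd p ≠ hd q) :
    (LV p.1 q.1 + LV p.1 (hd q)) + (LV (hd p) q.1 + LV (hd p) (hd q)) = rho p q + rho q p := by
  obtain ⟨⟨i, j⟩, b⟩ := p
  obtain ⟨⟨i', j'⟩, b'⟩ := q
  cases b <;> cases b' <;> simp only [hd, rho, if_true, if_false, Bool.false_eq_true] at *
  · simp only [LV, val_succ]
    simp only [ne_eq, Prod.mk.injEq, ← val_eq_iff, val_succ] at h1 h2 h3 h4
    rw [loc_vv hm (ZMod.val_lt i) (ZMod.val_lt i') (by tauto) (by tauto) (by tauto)]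
    simp only [← val_succ, ind_congr (val_eq_iff _ _)]
  · have a := loc_hv' i' i j' j h1.symm h3.symm h2.symm h4.symm
    have e1 := LV_anti _ _ h1
    have e2 := LV_anti _ _ h2
    have e3 := LV_anti _ _ h3
    have e4 := LV_anti _ _ h4
    have f : (1 : ZMod 2) + 1 = 0 := by decide
    rw [zero_add]
    have g := zmod2_add_self (ind (j' = -1) * (ind (i = i') + ind (i + 1 = i')))
    linear_combination e1 + e2 + e3 + e4 + 2 * f - a - g
  · rw [add_zero]
    exact loc_hv' i i' j j' h1 h2 h3 h4
  · simp only [LV, val_succ]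
    simp only [ne_eq, Prod.mk.injEq, ← val_eq_iff, val_succ] at h1 h2 h3 h4
    rw [loc_hh (n := n) (ZMod.val_lt j) (ZMod.val_lt j') (by tauto), add_zero]

lemma prefix_sum (c : ZMod n → ZMod 2) (K : ℕ) (hK : K ≤ n) :
    ∑ j : ZMod n, ind (j.val < K) * (1 + c j + c (j - 1)) =
      K + c (-1) + c ((K : ZMod n) - 1) := by
  induction K with
  | zero => simp [ind, zmod2_add_self]
  | succ K ih =>
    have h1 : ∀ j : ZMod n, ind (j.val < K + 1) = ind (j.val < K) + ind (j = (K : ZMod n)) := by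
      intro j
      have : j = (K : ZMod n) ↔ j.val = K := by
        rw [← val_eq_iff, ZMod.val_natCast, Nat.mod_eq_of_lt (by omega)]
      rw [ind_congr this]
      unfold ind
      split_ifs <;> first | omega | decide
    simp only [h1, add_mul, Finset.sum_add_distrib]
    rw [ih (by omega)]
    have h2 : ∑ j : ZMod n, ind (j = (K : ZMod n)) * (1 + c j + c (j - 1)) =
        1 + c K + c ((K : ZMod n) - 1) := by
      simp [ind]
    rw [h2]
    push_cast
    rw [add_sub_cancel_right]
    have := zmod2_add_self (c ((K : ZMod n) - 1))
    linear_combination this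

lemma full_sum (hn : Even n) (c : ZMod n → ZMod 2) :
    ∑ j : ZMod n, (1 + c j + c (j - 1)) = 0 := by
  have h := prefix_sum c n le_rfl
  have h1 : ∀ j : ZMod n, ind (j.val < n) = 1 := fun j => ind_eq1 (ZMod.val_lt j)
  simp only [h1, one_mul] at h
  rw [h]
  have : ((n : ℕ) : ZMod 2) = 0 := (ZMod.natCast_eq_zero_iff_even).2 hn
  simp [this, zmod2_add_self]

lemma sum_ind_mul {ι : Type*} [Fintype ι] [DecidableEq ι] (x : ι) (f : ι → ZMod 2) :
    ∑ i, ind (i = x) * f i = f x := by simp [ind]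

lemma grid_sum (hn : Even n) (c d : ZMod m → ZMod n → ZMod 2)
    (H1 : ∀ i j, c i j + c i (j - 1) + d i j + d (i - 1) j = 1)
    (H2 : ∀ i j, d i j * c (i + 1) (j - 1) = 0) :
    ∑ p : TorV m n × Bool, ∑ q : TorV m n × Bool,
      (if p.2 then c p.1.1 p.1.2 else d p.1.1 p.1.2) *
      ((if q.2 then c q.1.1 q.1.2 else d q.1.1 q.1.2) * rho p q) =
    ∑ j : ZMod n, (∑ i : ZMod m, d i j) * (j.val : ZMod 2) +
      (∑ j, d (-1) j) * (∑ i, c i (-1)) := by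
  have two : (2 : ZMod 2) = 0 := by decide
  have H1' : ∀ i j, d i j + d (i - 1) j = 1 + c i j + c i (j - 1) := by
    intro i j
    linear_combination H1 i j - (c i j + c i (j - 1)) * two
  -- inner sum, horizontal
  have inner_h : ∀ (i : ZMod m) (k : ZMod n),
      ∑ q : TorV m n × Bool, (if q.2 then c q.1.1 q.1.2 else d q.1.1 q.1.2) *
        rho (((i, k), true) : TorV m n × Bool) q = 0 := by
    intro i k
    rw [Fintype.sum_prod_type]
    simp only [Fintype.sum_bool, rho, if_true, if_false, Bool.false_eq_true, mul_zero, zero_add]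
    rw [Fintype.sum_prod_type_right]
    have : ∀ j : ZMod n, ∑ i' : ZMod m, d i' j * (ind (k = -1) * (ind (i' = i) + ind (i' + 1 = i)))
        = ind (k = -1) * (1 + c i j + c i (j - 1)) := by
      intro j
      rw [← H1']
      have e1 := sum_ind_mul i (fun i' => d i' j)
      have e2 := sum_ind_mul (i - 1) (fun i' => d i' j)
      rw [← e1, ← e2, ← Finset.sum_add_distrib, Finset.mul_sum]
      refine Finset.sum_congr rfl fun i' _ => ?_
      rw [ind_congr (p := i' + 1 = i) (q := i' = i - 1) eq_sub_iff_add_eq.symm]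
      ring
    simp only [this]
    rw [← Finset.mul_sum, full_sum hn, mul_zero]
  have inner_v : ∀ (i : ZMod m) (k : ZMod n),
      ∑ q : TorV m n × Bool, (if q.2 then c q.1.1 q.1.2 else d q.1.1 q.1.2) *
        rho (((i, k), false) : TorV m n × Bool) q =
      k.val + c (i + 1) (-1) + c (i + 1) (k - 1) := by
    intro i k
    rw [Fintype.sum_prod_type]
    simp only [Fintype.sum_bool, rho, if_true, if_false, Bool.false_eq_true, mul_zero, zero_add]
    rw [Fintype.sum_prod_type_right]
    have : ∀ j : ZMod n, ∑ i' : ZMod m, d i' j *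
        (ind (j.val < k.val) * (ind (i' = i + 1) + ind (i' + 1 = i + 1)))
        = ind (j.val < k.val) * (1 + c (i + 1) j + c (i + 1) (j - 1)) := by
      intro j
      rw [← H1', add_sub_cancel_right]
      have e1 := sum_ind_mul (i + 1) (fun i' => d i' j)
      have e2 := sum_ind_mul i (fun i' => d i' j)
      rw [← e1, ← e2, ← Finset.sum_add_distrib, Finset.mul_sum]
      refine Finset.sum_congr rfl fun i' _ => ?_
      rw [ind_congr (p := i' + 1 = i + 1) (q := i' = i) (by simp)]
      ring
    simp only [this]
    rw [prefix_sum _ _ (ZMod.val_lt k).le, ZMod.natCast_zmod_val]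
  -- constant layer parity
  have par1 : ∀ i, ∑ j, d i j = ∑ j, d (i - 1) j := by
    intro i
    have := full_sum hn (c i)
    simp only [← H1', Finset.sum_add_distrib] at this
    linear_combination this - (∑ j, d (i - 1) j) * two
  have par2 : ∀ k : ℕ, ∑ j, d ((k : ZMod m) - 1) j = ∑ j, d (-1) j := by
    intro k
    induction k with
    | zero => simp
    | succ k ih => rw [← ih, ← par1 (k : ZMod m)]; push_cast; rw [add_sub_cancel_right]
  have par : ∀ i, ∑ j, d i j = ∑ j, d (-1) j := by
    intro i
    rw [← par2 (i + 1).val, ZMod.natCast_zmod_val, add_sub_cancel_right]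
  simp only [← Finset.mul_sum]
  rw [Fintype.sum_prod_type]
  simp only [Fintype.sum_bool]
  rw [Fintype.sum_prod_type]
  simp only [inner_h, inner_v, if_true, if_false, Bool.false_eq_true, mul_zero, zero_add, mul_add,
    H2, add_zero, Finset.sum_add_distrib]
  congr 1
  · rw [Finset.sum_comm]
    simp only [Finset.sum_mul]
  · simp only [← Finset.sum_mul, par]
    rw [← Finset.mul_sum]
    congr 1
    exact Equiv.sum_comp (Equiv.addRight (1 : ZMod m)) (fun i => c i (-1))

end Grid

section Edges
set_option linter.unusedSectionVars false
variable {m n : ℕ} [NeZero m] [NeZero n]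

/-- The undirected edge of a parameter. -/
def edg (p : TorV m n × Bool) : Sym2 (TorV m n) := s(p.1, hd p)

/-- Colour of a vertex. -/
def clr (v : TorV m n) : ZMod 2 := (v.1.val : ZMod 2) + (v.2.val : ZMod 2)

lemma cast_val_succ (hm : Even m) (i : ZMod m) :
    ((i + 1).val : ZMod 2) = (i.val : ZMod 2) + 1 := by
  have h0 : ((m : ℕ) : ZMod 2) = 0 := (ZMod.natCast_eq_zero_iff_even).2 hm
  rw [val_succ]
  rcases cs_cases m i.val with h | h
  · rw [h.2, ← Nat.cast_add_one, h.1, h0, Nat.cast_zero]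
  · rw [h.2, Nat.cast_add_one]

lemma clr_hd (hm : Even m) (hn : Even n) (p : TorV m n × Bool) : clr (hd p) = clr p.1 + 1 := by
  unfold clr hd
  split_ifs
  · simp only [cast_val_succ hn]; ring
  · simp only [cast_val_succ hm]; ring

lemma one_ne (hm : 2 < m) : (1 : ZMod m) ≠ 0 := by
  have : Fact (1 < m) := ⟨by omega⟩
  exact one_ne_zero

lemma two_ne (hm : 2 < m) : (1 : ZMod m) + 1 ≠ 0 := by
  intro h
  have h2 : ((2 : ℕ) : ZMod m) = 0 := by push_cast; rw [← h]; norm_num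
  rw [ZMod.natCast_eq_zero_iff] at h2
  have := Nat.le_of_dvd (by norm_num) h2
  omega

lemma edg_inj (hm : 2 < m) (hn : 2 < n) : Function.Injective (edg (m := m) (n := n)) := by
  rintro ⟨⟨i, j⟩, b⟩ ⟨⟨i', j'⟩, b'⟩ h
  have m1 := one_ne hm
  have n1 := one_ne hn
  have m2 := two_ne hm
  have n2 := two_ne hn
  unfold edg hd at h
  rw [Sym2.eq_iff] at h
  cases b <;> cases b' <;>
    simp only [Bool.false_eq_true, if_true, if_false, Prod.mk.injEq] at h ⊢ <;>
    rcases h with ⟨⟨h1, h2⟩, h3, h4⟩ | ⟨⟨h1, h2⟩, h3, h4⟩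
  · simp [h1, h2]
  · exact absurd (by linear_combination h3 - h1) m2
  · exact absurd (by linear_combination h3 - h1) m1
  · exact absurd (by linear_combination h4 - h2) n1
  · exact absurd (by linear_combination h4 - h2) n1
  · exact absurd (by linear_combination h3 - h1) m1
  · simp [h1, h2]
  · exact absurd (by linear_combination h4 - h2) n2

lemma adj_iff (u w : TorV m n) : torAdj m n u w ↔ ∃ p, edg p = s(u, w) := by
  obtain ⟨i, j⟩ := u
  obtain ⟨i', j'⟩ := w
  constructor
  · rintro (⟨h1, h2 | h2⟩ | ⟨h1, h2 | h2⟩) <;> simp only at h1 h2 <;> subst h1 h2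
    · exact ⟨((i, j'), true), by simp [edg, hd, Sym2.eq_swap]⟩
    · exact ⟨((i, j), true), by simp [edg, hd]⟩
    · exact ⟨((i', j), false), by simp [edg, hd, Sym2.eq_swap]⟩
    · exact ⟨((i, j), false), by simp [edg, hd]⟩
  · rintro ⟨⟨⟨a, b⟩, t⟩, h⟩
    unfold edg hd at h
    unfold torAdj
    rw [Sym2.eq_iff] at h
    cases t <;> simp only [Bool.false_eq_true, if_true, if_false, Prod.mk.injEq] at h ⊢ <;>
      rcases h with ⟨⟨h1, h2⟩, h3, h4⟩ | ⟨⟨h1, h2⟩, h3, h4⟩ <;> subst h1 h2 h3 h4 <;> simp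

lemma pm_edge {M : Finset (Sym2 (TorV m n))} (hM : IsPM m n M) {e : Sym2 (TorV m n)} (he : e ∈ M) :
    ∃ p, edg p = e := by
  induction e using Sym2.ind with
  | _ x y => exact (adj_iff x y).1 (hM.1 _ he x y rfl)

lemma pm_unique {M : Finset (Sym2 (TorV m n))} (hM : IsPM m n M) {e e' : Sym2 (TorV m n)}
    (he : e ∈ M) (he' : e' ∈ M) {x : TorV m n} (hx : x ∈ e) (hx' : x ∈ e') : e = e' :=
  (hM.2 x).unique ⟨he, hx⟩ ⟨he', hx'⟩

lemma mem_edg (x : TorV m n) (p : TorV m n × Bool) : x ∈ edg p ↔ x = p.1 ∨ x = hd p := by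
  simp [edg]

lemma pm_H2 (hm : 2 < m) (hn : 2 < n) {M : Finset (Sym2 (TorV m n))} (hM : IsPM m n M)
    (i : ZMod m) (j : ZMod n) :
    ind (edg ((i, j), false) ∈ M) * ind (edg ((i + 1, j - 1), true) ∈ M) = 0 := by
  unfold ind
  split_ifs with h1 h2
  · have := pm_unique hM h1 h2 (x := (i + 1, j)) (by simp [mem_edg, hd]) (by simp [mem_edg, hd])
    have := edg_inj hm hn this
    simp at this
  all_goals simp

lemma pm_H1 (hm : 2 < m) (hn : 2 < n) {M : Finset (Sym2 (TorV m n))} (hM : IsPM m n M)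
    (i : ZMod m) (j : ZMod n) :
    ind (edg ((i, j), true) ∈ M) + ind (edg ((i, j - 1), true) ∈ M) +
    ind (edg ((i, j), false) ∈ M) + ind (edg ((i - 1, j), false) ∈ M) = 1 := by
  have m1 := one_ne hm
  have n1 := one_ne hn
  have uq : ∀ p q : TorV m n × Bool, (i, j) ∈ edg p → (i, j) ∈ edg q → edg p ∈ M → edg q ∈ M →
      p = q := fun p q a b c d => edg_inj hm hn (pm_unique hM c d a b)
  have e1 : ((i, j) : TorV m n) ∈ edg (((i, j), true) : TorV m n × Bool) := by simp [mem_edg]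
  have e2 : ((i, j) : TorV m n) ∈ edg (((i, j - 1), true) : TorV m n × Bool) := by
    simp [mem_edg, hd]
  have e3 : ((i, j) : TorV m n) ∈ edg (((i, j), false) : TorV m n × Bool) := by simp [mem_edg]
  have e4 : ((i, j) : TorV m n) ∈ edg (((i - 1, j), false) : TorV m n × Bool) := by
    simp [mem_edg, hd]
  have u12 := uq _ _ e1 e2
  have u13 := uq _ _ e1 e3
  have u14 := uq _ _ e1 e4
  have u23 := uq _ _ e2 e3
  have u24 := uq _ _ e2 e4
  have u34 := uq _ _ e3 e4
  have ex : edg (((i, j), true) : TorV m n × Bool) ∈ M ∨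
      edg (((i, j - 1), true) : TorV m n × Bool) ∈ M ∨
      edg (((i, j), false) : TorV m n × Bool) ∈ M ∨
      edg (((i - 1, j), false) : TorV m n × Bool) ∈ M := by
    obtain ⟨e, ⟨he, hx⟩, -⟩ := hM.2 (i, j)
    obtain ⟨⟨⟨a, b⟩, t⟩, rfl⟩ := pm_edge hM he
    rw [mem_edg] at hx
    unfold hd at hx
    cases t <;> simp only [Bool.false_eq_true, if_true, if_false, Prod.mk.injEq] at hx <;>
      rcases hx with ⟨h1, h2⟩ | ⟨h1, h2⟩ <;> subst h1 h2 <;>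
      simp only [add_sub_cancel_right, he, true_or, or_true]
  simp only [Prod.mk.injEq, Bool.true_eq_false, Bool.false_eq_true, and_false, and_true, true_and,
    eq_comm (a := i), eq_comm (a := j), sub_eq_self, m1, n1] at u12 u13 u14 u23 u24 u34
  clear uq e1 e2 e3 e4 hM
  by_cases a1 : edg (((i, j), true) : TorV m n × Bool) ∈ M <;>
  by_cases a2 : edg (((i, j - 1), true) : TorV m n × Bool) ∈ M <;>
  by_cases a3 : edg (((i, j), false) : TorV m n × Bool) ∈ M <;>
  by_cases a4 : edg (((i - 1, j), false) : TorV m n × Bool) ∈ M <;>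
  simp only [a1, a2, a3, a4, imp_self, true_imp_iff, or_self] at u12 u13 u14 u23 u24 u34 ex <;>
  simp [ind, a1, a2, a3, a4]

lemma card_inter_image {ι α : Type*} [Fintype ι] [DecidableEq α] (M : Finset α) (f : ι → α)
    (hf : Function.Injective f) :
    (M ∩ Finset.univ.image f).card = ∑ j, if f j ∈ M then 1 else 0 := by
  classical
  have : M ∩ Finset.univ.image f = (Finset.univ.filter (fun j => f j ∈ M)).image f := by
    ext x
    simp only [Finset.mem_inter, Finset.mem_image, Finset.mem_univ, true_and, Finset.mem_filter]
    constructor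
    · rintro ⟨h, j, rfl⟩; exact ⟨j, h, rfl⟩
    · rintro ⟨j, h, rfl⟩; exact ⟨h, j, rfl⟩
  rw [this, Finset.card_image_of_injective _ hf, Finset.card_filter]

lemma card_row (hm : 2 < m) (hn : 2 < n) (M : Finset (Sym2 (TorV m n))) (i : ZMod m) :
    (M ∩ rowEdges m n i).card = ∑ j, if edg ((i, j), true) ∈ M then 1 else 0 := by
  have := card_inter_image M (fun j : ZMod n => edg (((i, j), true) : TorV m n × Bool))
    (fun a b h => by simpa using edg_inj hm hn h)
  rw [← this]; rfl

lemma card_col (hm : 2 < m) (hn : 2 < n) (M : Finset (Sym2 (TorV m n))) (j : ZMod n) :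
    (M ∩ colEdges m n j).card = ∑ i, if edg ((i, j), false) ∈ M then 1 else 0 := by
  have := card_inter_image M (fun i : ZMod m => edg (((i, j), false) : TorV m n × Bool))
    (fun a b h => by simpa using edg_inj hm hn h)
  rw [← this]; rfl

lemma card_A (hm : 2 < m) (hn : 2 < n) (M : Finset (Sym2 (TorV m n))) :
    (M ∩ layerA m n).card = ∑ j, if edg ((-1, j), false) ∈ M then 1 else 0 := by
  have := card_inter_image M (fun j : ZMod n => edg (((-1, j), false) : TorV m n × Bool))
    (fun a b h => by simpa using edg_inj hm hn h)
  rw [← this]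
  congr 2
  refine Finset.image_congr fun j _ => ?_
  simp [edg, hd, Sym2.eq_swap]

lemma card_B (hm : 2 < m) (hn : 2 < n) (M : Finset (Sym2 (TorV m n))) :
    (M ∩ layerB m n).card = ∑ i, if edg ((i, -1), true) ∈ M then 1 else 0 := by
  have := card_inter_image M (fun i : ZMod m => edg (((i, -1), true) : TorV m n × Bool))
    (fun a b h => by simpa using edg_inj hm hn h)
  rw [← this]
  congr 2
  refine Finset.image_congr fun j _ => ?_
  simp [edg, hd, Sym2.eq_swap]

/-- wrap-around indicator -/
def wrp (p : TorV m n × Bool) : ZMod 2 := if p.2 then ind (p.1.2 = -1) else ind (p.1.1 = -1)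

lemma LV_hd (hm : 2 < m) (hn : 2 < n) (p : TorV m n × Bool) : LV p.1 (hd p) = wrp p := by
  obtain ⟨⟨i, j⟩, t⟩ := p
  have hi := ZMod.val_lt i
  have hj := ZMod.val_lt j
  cases t <;> simp only [LV, hd, wrp, Bool.false_eq_true, if_true, if_false, val_succ,
    ← val_succ_eq]
  · rcases cs_cases m i.val with h | h <;> rw [h.2] <;> unfold LN ind <;>
      split_ifs <;> first | rfl | omega
  · rcases cs_cases n j.val with h | h <;> rw [h.2] <;> unfold LN ind <;>
      split_ifs <;> first | rfl | omega

lemma hd_ne (hm : 2 < m) (hn : 2 < n) (p : TorV m n × Bool) : p.1 ≠ hd p := by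
  obtain ⟨⟨i, j⟩, t⟩ := p
  have m1 := one_ne hm
  have n1 := one_ne hn
  cases t <;> simp [hd, m1, n1]

lemma LV_neg (hm : 2 < m) (hn : 2 < n) (p : TorV m n × Bool) (b w : TorV m n)
    (h : edg p = s(b, w)) : LV b w + ind (p.1 ≠ b) = wrp p := by
  unfold edg at h
  rw [Sym2.eq_iff] at h
  rcases h with ⟨h1, h2⟩ | ⟨h1, h2⟩
  · rw [← h1, ← h2, LV_hd hm hn, ind_eq0 (by simp), add_zero]
  · rw [← h1, ← h2, ind_eq1 (hd_ne hm hn p), ← LV_hd hm hn p]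
    have := LV_anti _ _ (hd_ne hm hn p)
    have := zmod2_add_self (LV p.1 (hd p))
    grind

lemma exists_enum (hm : Even m) (hn : Even n) : ∃ (N : ℕ) (β ω : Fin N → TorV m n),
    Function.Injective β ∧ Function.Injective ω ∧ (∀ a a', a < a' → LV (ω a) (ω a') = 0) ∧
    (∀ v, (∃ a, β a = v) ↔ clr v = 0) ∧ (∀ v, (∃ a, ω a = v) ↔ clr v = 1) := by
  classical
  let κ : TorV m n → ℕ ×ₗ ℕ := fun v => toLex (v.1.val, v.2.val)
  have hκ : Function.Injective κ := by
    intro u v h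
    have h' : (u.1.val, u.2.val) = (v.1.val, v.2.val) := toLex.injective h
    rw [Prod.mk.injEq] at h'
    exact Prod.ext (ZMod.val_injective m h'.1) (ZMod.val_injective n h'.2)
  let _ : LinearOrder (TorV m n) := LinearOrder.lift' κ hκ
  let S0 : Finset (TorV m n) := Finset.univ.filter (fun v => clr v = 0)
  let S1 : Finset (TorV m n) := Finset.univ.filter (fun v => clr v = 1)
  have hc : S0.card = S1.card := by
    refine Finset.card_equiv (Equiv.addRight (((0 : ZMod m), (1 : ZMod n)) : TorV m n)) ?_
    rintro ⟨i, j⟩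
    have h := clr_hd hm hn (((i, j), true) : TorV m n × Bool)
    simp only [hd, if_true] at h
    simp only [S0, S1, Finset.mem_filter, Finset.mem_univ, true_and, Equiv.coe_addRight,
      Prod.mk_add_mk, add_zero, h]
    generalize clr ((i, j) : TorV m n) = x
    revert x; decide
  refine ⟨S1.card, S0.orderEmbOfFin hc, S1.orderEmbOfFin rfl, (S0.orderEmbOfFin hc).injective,
    (S1.orderEmbOfFin rfl).injective, ?_, ?_, ?_⟩
  · intro a a' h
    have h2 := (S1.orderEmbOfFin rfl).strictMono h
    have h3 : κ (S1.orderEmbOfFin rfl a) < κ (S1.orderEmbOfFin rfl a') := h2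
    rw [Prod.Lex.toLex_lt_toLex] at h3
    apply LN_eq0
    simp only at h3
    omega
  · intro v
    have := Set.ext_iff.1 (Finset.range_orderEmbOfFin S0 hc) v
    rw [Set.mem_range] at this
    rw [this]
    simp [S0]
  · intro v
    have := Set.ext_iff.1 (Finset.range_orderEmbOfFin S1 rfl) v
    rw [Set.mem_range] at this
    rw [this]
    simp [S1]

end Edges

section Main
set_option linter.unusedSectionVars false
variable {m n : ℕ} [NeZero m] [NeZero n]

/-- The edge set attached to a permutation. -/
def mst {N : ℕ} (β ω : Fin N → TorV m n) (σ : Equiv.Perm (Fin N)) : Finset (Sym2 (TorV m n)) :=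
  Finset.univ.image (fun a => s(β a, ω (σ a)))

lemma mem_mst {N : ℕ} (β ω : Fin N → TorV m n) (σ : Equiv.Perm (Fin N)) (e : Sym2 (TorV m n)) :
    e ∈ mst β ω σ ↔ ∃ a, s(β a, ω (σ a)) = e := by
  simp [mst]

lemma mst_inj {N : ℕ} (β ω : Fin N → TorV m n) (hβ : Function.Injective β)
    (hω : Function.Injective ω) (hβω : ∀ a b, β a ≠ ω b) : Function.Injective (mst β ω) := by
  intro σ τ h
  ext a
  have h1 : s(β a, ω (σ a)) ∈ mst β ω τ := by rw [← h, mem_mst]; exact ⟨a, rfl⟩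
  rw [mem_mst] at h1
  obtain ⟨b, hb⟩ := h1
  rw [Sym2.eq_iff] at hb
  rcases hb with ⟨h2, h3⟩ | ⟨h2, h3⟩
  · rw [← hω h3, hβ h2]
  · exact absurd h2 (hβω _ _)

lemma mst_pm {N : ℕ} (β ω : Fin N → TorV m n) (hβ : Function.Injective β)
    (hω : Function.Injective ω) (hβω : ∀ a b, β a ≠ ω b)
    (hcov : ∀ v, (∃ a, β a = v) ∨ (∃ a, ω a = v)) (σ : Equiv.Perm (Fin N)) :
    IsPM m n (mst β ω σ) ↔ ∀ a, ∃ p, edg p = s(β a, ω (σ a)) := by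
  constructor
  · intro h a
    exact pm_edge h ((mem_mst _ _ _ _).2 ⟨a, rfl⟩)
  · intro h
    refine ⟨?_, ?_⟩
    · intro e he x y hxy
      obtain ⟨a, ha⟩ := (mem_mst _ _ _ _).1 he
      rw [adj_iff, ← hxy, ← ha]
      exact h a
    · intro v
      rcases hcov v with ⟨a, rfl⟩ | ⟨b, rfl⟩
      · refine ⟨s(β a, ω (σ a)), ⟨(mem_mst _ _ _ _).2 ⟨a, rfl⟩, by simp⟩, ?_⟩
        rintro e ⟨he, hv⟩
        obtain ⟨c, rfl⟩ := (mem_mst _ _ _ _).1 he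
        rw [Sym2.mem_iff] at hv
        rcases hv with hv | hv
        · rw [hβ hv]
        · exact absurd hv (hβω _ _)
      · refine ⟨s(β (σ.symm b), ω (σ (σ.symm b))), ⟨(mem_mst _ _ _ _).2 ⟨_, rfl⟩, by simp⟩, ?_⟩
        rintro e ⟨he, hv⟩
        obtain ⟨c, rfl⟩ := (mem_mst _ _ _ _).1 he
        rw [Sym2.mem_iff] at hv
        rcases hv with hv | hv
        · exact absurd hv.symm (hβω _ _)
        · rw [hω hv]; simp

lemma mst_surj (hm : Even m) (hn : Even n) {N : ℕ} (β ω : Fin N → TorV m n)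
    (hβ : Function.Injective β)
    (hb : ∀ v, (∃ a, β a = v) ↔ clr v = 0) (hw : ∀ v, (∃ a, ω a = v) ↔ clr v = 1)
    (M : Finset (Sym2 (TorV m n))) (hM : IsPM m n M) : ∃ σ, mst β ω σ = M := by
  have key : ∀ p : TorV m n × Bool, ∃ a b, edg p = s(β a, ω b) := by
    intro p
    have h := clr_hd hm hn p
    have h01 : ∀ x : ZMod 2, x = 0 ∨ x = 1 := by decide
    rcases h01 (clr p.1) with h1 | h1
    · rw [h1, zero_add] at h
      obtain ⟨a, ha⟩ := (hb _).2 h1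
      obtain ⟨b, hb⟩ := (hw _).2 h
      exact ⟨a, b, by rw [ha, hb]; rfl⟩
    · rw [h1, zmod2_add_self] at h
      obtain ⟨a, ha⟩ := (hb _).2 h
      obtain ⟨b, hb⟩ := (hw _).2 h1
      exact ⟨a, b, by rw [ha, hb, Sym2.eq_swap]; rfl⟩
  have hβω : ∀ a b, β a ≠ ω b := by
    intro a b h
    have h1 := (hb (β a)).1 ⟨a, rfl⟩
    have h2 := (hw (β a)).1 ⟨b, h.symm⟩
    rw [h1] at h2
    exact absurd h2 (by decide)
  have ex : ∀ a, ∃ b, s(β a, ω b) ∈ M := by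
    intro a
    obtain ⟨e, ⟨he, hx⟩, -⟩ := hM.2 (β a)
    obtain ⟨p, rfl⟩ := pm_edge hM he
    obtain ⟨a', b, hab⟩ := key p
    rw [hab] at he hx
    rw [Sym2.mem_iff] at hx
    rcases hx with hx | hx
    · exact ⟨b, by rw [hx]; exact he⟩
    · exact absurd hx (hβω _ _)
  choose f hf using ex
  have finj : Function.Injective f := by
    intro a a' h
    have h2 := pm_unique hM (hf a) (hf a') (x := ω (f a)) (by simp) (by simp [h])
    rw [Sym2.eq_iff] at h2
    rcases h2 with h2 | h2
    · exact hβ h2.1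
    · exact absurd h2.1 (hβω _ _)
  refine ⟨Equiv.ofBijective f (Finite.injective_iff_bijective.1 finj), ?_⟩
  ext e
  rw [mem_mst]
  simp only [Equiv.ofBijective_apply]
  constructor
  · rintro ⟨a, rfl⟩; exact hf a
  · intro he
    obtain ⟨p, rfl⟩ := pm_edge hM he
    obtain ⟨a, b, hab⟩ := key p
    refine ⟨a, pm_unique hM (hf a) he (x := β a) (by simp) (by simp [hab])⟩

lemma transfer {N : ℕ} {A : Type*} [AddCommMonoid A] (π : Fin N → TorV m n × Bool)
    (hπ : Function.Injective π) (M : Finset (Sym2 (TorV m n)))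
    (hM : ∀ p, edg p ∈ M ↔ ∃ a, π a = p) (F : TorV m n × Bool → A) :
    ∑ a, F (π a) = ∑ p, if edg p ∈ M then F p else 0 := by
  classical
  rw [← Finset.sum_filter]
  have : Finset.univ.filter (fun p => edg p ∈ M) = Finset.univ.image π := by
    ext p; simp [hM]
  rw [this, Finset.sum_image (fun a _ b _ h => hπ h)]

lemma ind_mul_eq (p : Prop) [Decidable p] (x : ZMod 2) : (if p then x else 0) = ind p * x := by
  unfold ind; split_ifs <;> simp

lemma rho_self (p : TorV m n × Bool) : rho p p = 0 := by
  unfold rho; split_ifs <;> simp [ind]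

lemma pi_props (hm : 2 < m) (hn : 2 < n) {N : ℕ} (β ω : Fin N → TorV m n)
    (hβ : Function.Injective β) (hβω : ∀ a b, β a ≠ ω b)
    (σ : Equiv.Perm (Fin N)) (π : Fin N → TorV m n × Bool)
    (hπ : ∀ a, edg (π a) = s(β a, ω (σ a))) :
    Function.Injective π ∧ ∀ p, edg p ∈ mst β ω σ ↔ ∃ a, π a = p := by
  constructor
  · intro a b h
    have h1 := hπ a
    rw [h, hπ b, Sym2.eq_iff] at h1
    rcases h1 with h1 | h1
    · exact (hβ h1.1).symm
    · exact absurd h1.1 (hβω _ _)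
  · intro p
    rw [mem_mst]
    constructor
    · rintro ⟨a, ha⟩
      exact ⟨a, edg_inj hm hn (by rw [hπ, ha])⟩
    · rintro ⟨a, rfl⟩
      exact ⟨a, (hπ a).symm⟩

lemma exponent (hm : 2 < m) (hn : 2 < n) (en : Even n) {N : ℕ}
    (β ω : Fin N → TorV m n) (hβ : Function.Injective β)
    (hω : Function.Injective ω) (hβω : ∀ a b, β a ≠ ω b)
    (σ : Equiv.Perm (Fin N)) (π : Fin N → TorV m n × Bool)
    (hπ : ∀ a, edg (π a) = s(β a, ω (σ a))) (hM : IsPM m n (mst β ω σ)) :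
    ∑ a, LV (β a) (ω (σ a)) + ∑ a' : Fin N, ∑ a ∈ Finset.Iio a',
        ((LV (β a) (β a') + LV (β a) (ω (σ a'))) +
          (LV (ω (σ a)) (β a') + LV (ω (σ a)) (ω (σ a')))) + ∑ a, ind ((π a).1 ≠ β a) =
      ∑ j : ZMod n, (((mst β ω σ) ∩ colEdges m n j).card : ZMod 2) * (j.val : ZMod 2) +
        (((mst β ω σ) ∩ layerA m n).card : ZMod 2) * (((mst β ω σ) ∩ layerB m n).card : ZMod 2) +
        ((((mst β ω σ) ∩ layerA m n).card : ZMod 2) +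
          (((mst β ω σ) ∩ layerB m n).card : ZMod 2)) := by
  obtain ⟨πi, πM⟩ := pi_props hm hn β ω hβ hβω σ π hπ
  have h1 : ∑ a, LV (β a) (ω (σ a)) + ∑ a, ind ((π a).1 ≠ β a) = ∑ a, wrp (π a) := by
    rw [← Finset.sum_add_distrib]
    exact Finset.sum_congr rfl fun a _ => LV_neg hm hn _ _ _ (hπ a)
  have h2 : ∑ a' : Fin N, ∑ a ∈ Finset.Iio a',
        ((LV (β a) (β a') + LV (β a) (ω (σ a'))) +
          (LV (ω (σ a)) (β a') + LV (ω (σ a)) (ω (σ a')))) = ∑ a, ∑ a', rho (π a) (π a') := by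
    have := sum_pairs (fun a a' => rho (π a) (π a'))
    simp only [rho_self, Finset.sum_const_zero, add_zero] at this
    rw [← this]
    refine Finset.sum_congr rfl fun a' _ => Finset.sum_congr rfl fun a ha => ?_
    have hne : a ≠ a' := by
      intro h; simp [h] at ha
    have d1 : β a ≠ β a' := fun h => hne (hβ h)
    have d2 : ω (σ a) ≠ ω (σ a') := fun h => hne (σ.injective (hω h))
    have d3 := hβω a (σ a')
    have d4 := (hβω a' (σ a)).symm
    have e := hπ a
    have e' := hπ a'
    unfold edg at e e'
    rw [Sym2.eq_iff] at e e'
    rcases e with ⟨e1, e2⟩ | ⟨e1, e2⟩ <;> rcases e' with ⟨e3, e4⟩ | ⟨e3, e4⟩ <;>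
      rw [← loc_all hm (π a) (π a') (by rw [e1, e3]; assumption) (by rw [e1, e4]; assumption)
        (by rw [e2, e3]; assumption) (by rw [e2, e4]; assumption), e1, e2, e3, e4] <;> ring
  have h3 : ∑ a, ∑ a', rho (π a) (π a') =
      ∑ p : TorV m n × Bool, ∑ q : TorV m n × Bool,
      (if p.2 then ind (edg ((p.1.1, p.1.2), true) ∈ mst β ω σ)
        else ind (edg ((p.1.1, p.1.2), false) ∈ mst β ω σ)) *
      ((if q.2 then ind (edg ((q.1.1, q.1.2), true) ∈ mst β ω σ)
        else ind (edg ((q.1.1, q.1.2), false) ∈ mst β ω σ)) * rho p q) := by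
    rw [transfer π πi _ πM (fun p => ∑ a', rho p (π a'))]
    refine Finset.sum_congr rfl fun p _ => ?_
    rw [transfer π πi _ πM (fun q => rho p q), ind_mul_eq, Finset.mul_sum]
    refine Finset.sum_congr rfl fun q _ => ?_
    rw [ind_mul_eq]
    obtain ⟨p1, pb⟩ := p
    obtain ⟨q1, qb⟩ := q
    cases pb <;> cases qb <;> rfl
  have h4 := grid_sum en (fun i j => ind (edg ((i, j), true) ∈ mst β ω σ))
    (fun i j => ind (edg ((i, j), false) ∈ mst β ω σ)) (pm_H1 hm hn hM) (pm_H2 hm hn hM)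
  have h5 : ∑ a, wrp (π a) = ∑ j : ZMod n, ind (edg (((-1 : ZMod m), j), false) ∈ mst β ω σ) +
      ∑ i : ZMod m, ind (edg ((i, (-1 : ZMod n)), true) ∈ mst β ω σ) := by
    rw [transfer π πi _ πM wrp, Fintype.sum_prod_type]
    simp only [Fintype.sum_bool, Finset.sum_add_distrib, ind_mul_eq, wrp, if_true, if_false,
      Bool.false_eq_true]
    rw [add_comm]
    congr 1
    · rw [Fintype.sum_prod_type_right]
      refine Finset.sum_congr rfl fun j _ => ?_
      simp only [mul_comm _ (ind (_ = (-1 : ZMod m))), sum_ind_mul]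
    · rw [Fintype.sum_prod_type]
      refine Finset.sum_congr rfl fun i _ => ?_
      simp only [mul_comm _ (ind (_ = (-1 : ZMod n))), sum_ind_mul]
  simp only [card_A hm hn, card_B hm hn, card_col hm hn, Nat.cast_sum, Nat.cast_ite, Nat.cast_one,
    Nat.cast_zero]
  change _ = ∑ j : ZMod n, (∑ i : ZMod m, ind (edg ((i, j), false) ∈ mst β ω σ)) *
    (j.val : ZMod 2) + (∑ j : ZMod n, ind (edg (((-1 : ZMod m), j), false) ∈ mst β ω σ)) *
     (∑ i : ZMod m, ind (edg ((i, (-1 : ZMod n)), true) ∈ mst β ω σ)) +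
    (∑ j : ZMod n, ind (edg (((-1 : ZMod m), j), false) ∈ mst β ω σ) +
     ∑ i : ZMod m, ind (edg ((i, (-1 : ZMod n)), true) ∈ mst β ω σ))
  rw [← h4, ← h3, ← h2, ← h5, ← h1]
  ring

end Main

section Final
set_option linter.unusedSectionVars false
variable {m n : ℕ} [NeZero m] [NeZero n]

/-- The weight label of an edge. -/
def lab (p : TorV m n × Bool) : ZMod m ⊕ ZMod n := if p.2 then Sum.inl p.1.1 else Sum.inr p.1.2

/-- The antisymmetric weight. -/
noncomputable def wt (b w : TorV m n) : MvPolynomial (ZMod m ⊕ ZMod n) ℤ :=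
  ∑ p : TorV m n × Bool,
    ((if p.1 = b ∧ hd p = w then MvPolynomial.X (lab p) else 0) -
      (if hd p = b ∧ p.1 = w then MvPolynomial.X (lab p) else 0))

lemma sum_hd (w : TorV m n) {A : Type*} [AddCommMonoid A] (F : ZMod m ⊕ ZMod n → A) :
    (∑ p : TorV m n × Bool, if hd p = w then F (lab p) else 0) = F (Sum.inl w.1) + F (Sum.inr w.2)
    := by
  obtain ⟨i, j⟩ := w
  rw [Fintype.sum_prod_type]
  simp only [Fintype.sum_bool, Finset.sum_add_distrib, hd, lab, if_true, if_false,
    Bool.false_eq_true]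
  congr 1
  · rw [Finset.sum_eq_single ((i, j - 1) : TorV m n)]
    · simp
    · rintro ⟨a, b⟩ - h
      rw [if_neg]
      intro h2
      apply h
      simp only [Prod.mk.injEq] at h2 ⊢
      exact ⟨h2.1, by linear_combination h2.2⟩
    · simp
  · rw [Finset.sum_eq_single ((i - 1, j) : TorV m n)]
    · simp
    · rintro ⟨a, b⟩ - h
      rw [if_neg]
      intro h2
      apply h
      simp only [Prod.mk.injEq] at h2 ⊢
      exact ⟨by linear_combination h2.1, h2.2⟩
    · simp

lemma sum_tl (w : TorV m n) {A : Type*} [AddCommMonoid A] (F : ZMod m ⊕ ZMod n → A) :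
    (∑ p : TorV m n × Bool, if p.1 = w then F (lab p) else 0) = F (Sum.inl w.1) + F (Sum.inr w.2)
    := by
  rw [Fintype.sum_prod_type]
  simp only [Fintype.sum_bool, Finset.sum_add_distrib, lab, if_true, if_false,
    Bool.false_eq_true, Finset.sum_ite_eq', Finset.mem_univ]

lemma wt_rowsum (hm : Even m) (hn : Even n) {N : ℕ} (β : Fin N → TorV m n)
    (hβ : Function.Injective β) (hb : ∀ v, (∃ a, β a = v) ↔ clr v = 0) (w : TorV m n)
    (hw : clr w = 1) : ∑ a, wt (β a) w = 0 := by
  unfold wt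
  rw [Finset.sum_comm]
  have one : ∀ (x : TorV m n) (y : MvPolynomial (ZMod m ⊕ ZMod n) ℤ) (Q : Prop) [Decidable Q],
      (Q → clr x = 0) → (∑ a, if x = β a ∧ Q then y else 0) = if Q then y else 0 := by
    intro x y Q _ hQ
    by_cases h : Q
    · obtain ⟨a, rfl⟩ := (hb x).2 (hQ h)
      simp [h, hβ.eq_iff]
    · simp [h]
  have h1 : ∀ p : TorV m n × Bool, hd p = w → clr p.1 = 0 := by
    intro p h
    have := clr_hd hm hn p
    rw [h, hw] at this
    simpa using this.symm
  have h2 : ∀ p : TorV m n × Bool, p.1 = w → clr (hd p) = 0 := by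
    intro p h
    have := clr_hd hm hn p
    rw [this, h, hw]; decide
  simp only [Finset.sum_sub_distrib]
  rw [sub_eq_zero]
  have e1 := fun p : TorV m n × Bool => one p.1 (MvPolynomial.X (lab p)) (hd p = w) (h1 p)
  have e2 := fun p : TorV m n × Bool => one (hd p) (MvPolynomial.X (lab p)) (p.1 = w) (h2 p)
  simp only [e1, e2]
  rw [sum_hd w (fun l => MvPolynomial.X l), sum_tl w (fun l => MvPolynomial.X l)]

lemma wt_zero (b w : TorV m n) (h : ¬ ∃ p, edg p = s(b, w)) : wt b w = 0 := by
  unfold wt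
  apply Finset.sum_eq_zero
  intro p _
  rw [if_neg, if_neg, sub_zero]
  · rintro ⟨h1, h2⟩; exact h ⟨p, by rw [edg, h1, h2, Sym2.eq_swap]⟩
  · rintro ⟨h1, h2⟩; exact h ⟨p, by rw [edg, h1, h2]⟩

lemma wt_edge (hm : 2 < m) (hn : 2 < n) (b w : TorV m n) (p : TorV m n × Bool)
    (h : edg p = s(b, w)) :
    wt b w = MvPolynomial.monomial (Finsupp.single (lab p) 1) (eps (ind (p.1 ≠ b))) := by
  unfold wt
  rw [Finset.sum_eq_single p]
  · have h0 := hd_ne hm hn p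
    unfold edg at h
    rw [Sym2.eq_iff] at h
    rcases h with ⟨h1, h2⟩ | ⟨h1, h2⟩
    · subst h1 h2
      simp [ind, eps, h0, MvPolynomial.X]
    · subst h1 h2
      simp [ind, eps, h0, MvPolynomial.X]
  · intro q _ hq
    rw [if_neg, if_neg, sub_zero]
    · rintro ⟨h1, h2⟩; exact hq (edg_inj hm hn (by rw [h, edg, h1, h2, Sym2.eq_swap]))
    · rintro ⟨h1, h2⟩; exact hq (edg_inj hm hn (by rw [h, edg, h1, h2]))
  · simp

lemma prod_monomial {ι τ : Type*} (s : Finset ι) (f : ι → τ →₀ ℕ) (c : ι → ℤ) :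
    ∏ a ∈ s, MvPolynomial.monomial (f a) (c a) =
      MvPolynomial.monomial (∑ a ∈ s, f a) (∏ a ∈ s, c a) := by
  classical
  induction s using Finset.induction_on with
  | empty => simp
  | insert a s ha ih =>
    rw [Finset.prod_insert ha, Finset.sum_insert ha, Finset.prod_insert ha, ih,
      MvPolynomial.monomial_mul]

lemma main_big (hm : 2 < m) (hn : 2 < n) (em : Even m) (en : Even n)
    (h : ZMod m → ℕ) (v : ZMod n → ℕ) :
    {M : Finset (Sym2 (TorV m n)) | IsPM m n M ∧
        (Even (M ∩ layerA m n).card ∧ Even (M ∩ layerB m n).card) ∧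
        (∀ i, (M ∩ rowEdges m n i).card = h i) ∧
        (∀ j, (M ∩ colEdges m n j).card = v j)}.ncard =
    {M : Finset (Sym2 (TorV m n)) | IsPM m n M ∧
        ¬ (Even (M ∩ layerA m n).card ∧ Even (M ∩ layerB m n).card) ∧
        (∀ i, (M ∩ rowEdges m n i).card = h i) ∧
        (∀ j, (M ∩ colEdges m n j).card = v j)}.ncard := by
  classical
  obtain ⟨N, β, ω, hβ, hω, hmono, hb, hw⟩ := exists_enum em en
  have h01 : ∀ x : ZMod 2, x = 0 ∨ x = 1 := by decide
  have hβω : ∀ a b, β a ≠ ω b := by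
    intro a b h
    have h1 := (hb (β a)).1 ⟨a, rfl⟩
    have h2 := (hw (β a)).1 ⟨b, h.symm⟩
    rw [h1] at h2
    exact absurd h2 (by decide)
  have hcov : ∀ v, (∃ a, β a = v) ∨ (∃ a, ω a = v) := by
    intro v
    rw [hb, hw]; exact h01 _
  -- vanishing determinant
  let K : Matrix (Fin N) (Fin N) (MvPolynomial (ZMod m ⊕ ZMod n) ℤ) :=
    Matrix.of fun b a => wt (β a) (ω b)
  have hdet : K.det = 0 := by
    rw [← Matrix.exists_mulVec_eq_zero_iff]
    refine ⟨fun _ => 1, ?_, ?_⟩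
    · obtain ⟨a, -⟩ := (hb (0, 0)).2 (by simp [clr])
      intro h0
      have := congrFun h0 a
      simp at this
    · ext1 b
      have := wt_rowsum em en β hβ hb (ω b) ((hw _).1 ⟨b, rfl⟩)
      simpa [Matrix.mulVec, dotProduct, K] using this
  obtain ⟨C, hC⟩ := sign_formula LV LV_anti β ω hmono hω hβω
  let good : Equiv.Perm (Fin N) → Prop := fun σ => IsPM m n (mst β ω σ) ∧
        (∀ i, (mst β ω σ ∩ rowEdges m n i).card = h i) ∧
        (∀ j, (mst β ω σ ∩ colEdges m n j).card = v j)
  let ev : Equiv.Perm (Fin N) → Prop := fun σ =>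
    Even (mst β ω σ ∩ layerA m n).card ∧ Even (mst β ω σ ∩ layerB m n).card
  let t : (ZMod m ⊕ ZMod n) →₀ ℕ := Finsupp.equivFunOnFinite.symm (Sum.elim h v)
  let C0 : ZMod 2 := C + ∑ j : ZMod n, (v j : ZMod 2) * (j.val : ZMod 2)
  have term : ∀ σ : Equiv.Perm (Fin N),
      ((Equiv.Perm.sign σ : ℤˣ) : ℤ) * MvPolynomial.coeff t (∏ a, K (σ a) a) =
      if good σ then eps C0 * (if ev σ then 1 else -1) else 0 := by
    intro σ
    by_cases hv : IsPM m n (mst β ω σ)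
    · have hp := (mst_pm β ω hβ hω hβω hcov σ).1 hv
      choose π hπ using hp
      obtain ⟨πi, πM⟩ := pi_props hm hn β ω hβ hβω σ π hπ
      have hprod : ∏ a, K (σ a) a = MvPolynomial.monomial
          (∑ a, Finsupp.single (lab (π a)) 1) (∏ a, eps (ind ((π a).1 ≠ β a))) := by
        rw [← prod_monomial]
        exact Finset.prod_congr rfl fun a _ => wt_edge hm hn _ _ _ (hπ a)
      have htype : (∑ a, Finsupp.single (lab (π a)) 1 = t) ↔
          (∀ i, (mst β ω σ ∩ rowEdges m n i).card = h i) ∧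
          (∀ j, (mst β ω σ ∩ colEdges m n j).card = v j) := by
        have hx : ∀ l, (∑ a, Finsupp.single (lab (π a)) 1 : (ZMod m ⊕ ZMod n) →₀ ℕ) l =
            ∑ p, if edg p ∈ mst β ω σ then (if lab p = l then 1 else 0) else 0 := by
          intro l
          rw [← transfer π πi _ πM (fun p => if lab p = l then 1 else 0)]
          simp [Finsupp.single_apply]
        have hl : ∀ i, (∑ a, Finsupp.single (lab (π a)) 1 : (ZMod m ⊕ ZMod n) →₀ ℕ) (Sum.inl i) =
            (mst β ω σ ∩ rowEdges m n i).card := by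
          intro i
          rw [hx, card_row hm hn, Fintype.sum_prod_type, Fintype.sum_prod_type,
            Finset.sum_eq_single i]
          · simp [lab]
          · intro i' _ hi; simp [lab, hi]
          · simp
        have hr : ∀ j, (∑ a, Finsupp.single (lab (π a)) 1 : (ZMod m ⊕ ZMod n) →₀ ℕ) (Sum.inr j) =
            (mst β ω σ ∩ colEdges m n j).card := by
          intro j
          rw [hx, card_col hm hn, Fintype.sum_prod_type, Fintype.sum_prod_type_right,
            Finset.sum_eq_single j]
          · simp [lab]
          · intro i' _ hi; simp [lab, hi]
          · simp
        rw [DFunLike.ext_iff, Sum.forall]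
        simp only [hl, hr]
        rfl
      rw [hprod, MvPolynomial.coeff_monomial]
      by_cases hT : (∀ i, (mst β ω σ ∩ rowEdges m n i).card = h i) ∧
          (∀ j, (mst β ω σ ∩ colEdges m n j).card = v j)
      · have hg : good σ := ⟨hv, hT⟩
        rw [if_pos (htype.2 hT), if_pos hg, hC σ, ← eps_sum, ← eps_add]
        have hexp := exponent hm hn en β ω hβ hω hβω σ π hπ hv
        simp only [hT.2] at hexp
        rw [show ∀ A B D E : ZMod 2, (A + B + D) + E = A + (B + D + E) by intros; ring]
        rw [hexp]
        rw [show ∀ A B D E : ZMod 2, A + (B + D + E) = (A + B) + (D + E) by intros; ring]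
        rw [eps_add]
        congr 1
        have hA := ZMod.natCast_eq_zero_iff_even (n := (mst β ω σ ∩ layerA m n).card)
        have hB := ZMod.natCast_eq_zero_iff_even (n := (mst β ω σ ∩ layerB m n).card)
        have hev : ev σ ↔ (((mst β ω σ ∩ layerA m n).card : ZMod 2) = 0 ∧
          ((mst β ω σ ∩ layerB m n).card : ZMod 2) = 0) := by rw [hA, hB]
        rw [if_congr hev rfl rfl]
        generalize ((mst β ω σ ∩ layerA m n).card : ZMod 2) = x
        generalize ((mst β ω σ ∩ layerB m n).card : ZMod 2) = y
        revert x y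
        decide
      · have hg : ¬ good σ := fun hg => hT hg.2
        rw [if_neg (fun h => hT (htype.1 h)), if_neg hg, mul_zero]
    · have hg : ¬ good σ := fun hg => hv hg.1
      rw [if_neg hg]
      rw [mst_pm β ω hβ hω hβω hcov σ] at hv
      rw [not_forall] at hv
      obtain ⟨a, ha⟩ := hv
      have : ∏ a, K (σ a) a = 0 := Finset.prod_eq_zero (Finset.mem_univ a) (wt_zero _ _ ha)
      rw [this]; simp
  have hsum : ∑ σ : Equiv.Perm (Fin N),
      (if good σ then eps C0 * (if ev σ then 1 else -1) else 0) = 0 := by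
    have h0 : MvPolynomial.coeff t K.det = 0 := by rw [hdet]; simp
    rw [Matrix.det_apply', MvPolynomial.coeff_sum] at h0
    refine Eq.trans ?_ h0
    refine Finset.sum_congr rfl fun σ _ => ?_
    rw [← term σ]
    have : (((Equiv.Perm.sign σ : ℤˣ) : ℤ) : MvPolynomial (ZMod m ⊕ ZMod n) ℤ) =
        MvPolynomial.C (((Equiv.Perm.sign σ : ℤˣ) : ℤ)) := by simp
    rw [this, MvPolynomial.coeff_C_mul]
  have hcard : (Finset.univ.filter (fun σ => good σ ∧ ev σ)).card =
      (Finset.univ.filter (fun σ => good σ ∧ ¬ ev σ)).card := by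
    have hne : eps C0 ≠ 0 := by unfold eps; split_ifs <;> simp
    have h1 : ∑ σ : Equiv.Perm (Fin N),
        ((if good σ ∧ ev σ then (1 : ℤ) else 0) - (if good σ ∧ ¬ ev σ then 1 else 0)) = 0 := by
      apply mul_left_cancel₀ hne
      rw [mul_zero, Finset.mul_sum]
      refine Eq.trans ?_ hsum
      refine Finset.sum_congr rfl fun σ _ => ?_
      by_cases g : good σ <;> by_cases e : ev σ <;> simp [g, e]
    rw [Finset.sum_sub_distrib, Finset.sum_boole, Finset.sum_boole, sub_eq_zero] at h1
    exact_mod_cast h1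
  have fin : ∀ Q : Finset (Sym2 (TorV m n)) → Prop,
      {M : Finset (Sym2 (TorV m n)) | IsPM m n M ∧ Q M ∧
        (∀ i, (M ∩ rowEdges m n i).card = h i) ∧
        (∀ j, (M ∩ colEdges m n j).card = v j)}.ncard =
      (Finset.univ.filter (fun σ => good σ ∧ Q (mst β ω σ))).card := by
    intro Q
    rw [← Set.ncard_coe_finset, ← Set.ncard_image_of_injective _ (mst_inj β ω hβ hω hβω)]
    congr 1
    ext M
    simp only [Set.mem_ofPred_eq, Set.mem_image, Finset.coe_filter, Finset.mem_univ, true_and]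
    constructor
    · rintro ⟨h1, h2, h3⟩
      obtain ⟨σ, rfl⟩ := mst_surj em en β ω hβ hb hw M h1
      exact ⟨σ, ⟨⟨h1, h3⟩, h2⟩, rfl⟩
    · rintro ⟨σ, ⟨⟨h1, h3⟩, h2⟩, rfl⟩
      exact ⟨h1, h2, h3⟩
  rw [fin (fun M => Even (M ∩ layerA m n).card ∧ Even (M ∩ layerB m n).card),
    fin (fun M => ¬ (Even (M ∩ layerA m n).card ∧ Even (M ∩ layerB m n).card))]
  convert hcard

lemma no_m2 (hm : m = 2) (M : Finset (Sym2 (TorV m n))) (hM : IsPM m n M)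
    (hr : ∀ i, 0 < (M ∩ rowEdges m n i).card) (hc : ∀ j, 0 < (M ∩ colEdges m n j).card) :
    False := by
  subst hm
  obtain ⟨e, he⟩ := Finset.card_pos.1 (hr 0)
  simp only [rowEdges, Finset.mem_inter, Finset.mem_image, Finset.mem_univ, true_and] at he
  obtain ⟨he, j, rfl⟩ := he
  obtain ⟨e, he'⟩ := Finset.card_pos.1 (hc j)
  simp only [colEdges, Finset.mem_inter, Finset.mem_image, Finset.mem_univ, true_and] at he'
  obtain ⟨he', i, rfl⟩ := he'
  have hi0 : ∀ i : ZMod 2, (0 : ZMod 2) = i ∨ (0 : ZMod 2) = i + 1 := by decide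
  have hi2 : ∀ i : ZMod 2, i + 1 ≠ i := by decide
  have hi := hi0 i
  have hi1 := hi2 i
  have := pm_unique hM he he' (x := ((0 : ZMod 2), j)) (by simp)
    (by rw [Sym2.mem_iff]; simpa using hi)
  rw [Sym2.eq_iff] at this
  simp only [Prod.mk.injEq] at this
  rcases this with h | h
  · exact hi1 (h.2.1.symm.trans h.1.1)
  · exact hi1 (h.1.1.symm.trans h.2.1)

lemma no_n2 (hn : n = 2) (M : Finset (Sym2 (TorV m n))) (hM : IsPM m n M)
    (hr : ∀ i, 0 < (M ∩ rowEdges m n i).card) (hc : ∀ j, 0 < (M ∩ colEdges m n j).card) :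
    False := by
  subst hn
  obtain ⟨e, he⟩ := Finset.card_pos.1 (hc 0)
  simp only [colEdges, Finset.mem_inter, Finset.mem_image, Finset.mem_univ, true_and] at he
  obtain ⟨he, j, rfl⟩ := he
  obtain ⟨e, he'⟩ := Finset.card_pos.1 (hr j)
  simp only [rowEdges, Finset.mem_inter, Finset.mem_image, Finset.mem_univ, true_and] at he'
  obtain ⟨he', i, rfl⟩ := he'
  have hi0 : ∀ i : ZMod 2, (0 : ZMod 2) = i ∨ (0 : ZMod 2) = i + 1 := by decide
  have hi2 : ∀ i : ZMod 2, i + 1 ≠ i := by decide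
  have hi := hi0 i
  have hi1 := hi2 i
  have := pm_unique hM he he' (x := (j, (0 : ZMod 2))) (by simp)
    (by rw [Sym2.mem_iff]; simpa using hi)
  rw [Sym2.eq_iff] at this
  simp only [Prod.mk.injEq] at this
  rcases this with h | h
  · exact hi1 (h.2.2.symm.trans h.1.2)
  · exact hi1 (h.1.2.symm.trans h.2.2)

end Final

/-- main theorem: for `m, n` positive even and positive integer
vectors `h : ZMod m → ℕ`, `v : ZMod n → ℕ`, the number of even perfect matchings
(`|M ∩ A|`, `|M ∩ B|` both even) with exactly `h i` horizontal edges in row `i`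
and `v j` vertical edges in column `j` equals the number of odd perfect matchings
with the same row and column counts. -/
theorem even_eq_odd_matchings (m n : ℕ) [NeZero m] [NeZero n]
    (hm : Even m) (hn : Even n)
    (h : ZMod m → ℕ) (v : ZMod n → ℕ)
    (hh : ∀ i, 0 < h i) (hv : ∀ j, 0 < v j) :
    {M : Finset (Sym2 (TorV m n)) | IsPM m n M ∧
        (Even (M ∩ layerA m n).card ∧ Even (M ∩ layerB m n).card) ∧
        (∀ i, (M ∩ rowEdges m n i).card = h i) ∧
        (∀ j, (M ∩ colEdges m n j).card = v j)}.ncard =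
    {M : Finset (Sym2 (TorV m n)) | IsPM m n M ∧
        ¬ (Even (M ∩ layerA m n).card ∧ Even (M ∩ layerB m n).card) ∧
        (∀ i, (M ∩ rowEdges m n i).card = h i) ∧
        (∀ j, (M ∩ colEdges m n j).card = v j)}.ncard := by
  have pos_m : 0 < m := Nat.pos_of_ne_zero (NeZero.ne m)
  have pos_n : 0 < n := Nat.pos_of_ne_zero (NeZero.ne n)
  by_cases hsmall : m = 2 ∨ n = 2
  · have key : ∀ Q : Finset (Sym2 (TorV m n)) → Prop,
        {M : Finset (Sym2 (TorV m n)) | IsPM m n M ∧ Q M ∧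
          (∀ i, (M ∩ rowEdges m n i).card = h i) ∧
          (∀ j, (M ∩ colEdges m n j).card = v j)} = ∅ := by
      intro Q
      rw [Set.eq_empty_iff_forall_notMem]
      rintro M ⟨h1, -, h2, h3⟩
      rcases hsmall with h4 | h4
      · exact no_m2 h4 M h1 (fun i => by rw [h2]; exact hh i) (fun j => by rw [h3]; exact hv j)
      · exact no_n2 h4 M h1 (fun i => by rw [h2]; exact hh i) (fun j => by rw [h3]; exact hv j)
    rw [key (fun M => Even (M ∩ layerA m n).card ∧ Even (M ∩ layerB m n).card),
      key (fun M => ¬ (Even (M ∩ layerA m n).card ∧ Even (M ∩ layerB m n).card))]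
  · rw [not_or] at hsmall
    obtain ⟨k, hk⟩ := hm
    obtain ⟨l, hl⟩ := hn
    exact main_big (by omega) (by omega) ⟨k, hk⟩ ⟨l, hl⟩ h v
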